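/- Let (X, μ) be a measure space, 1 ≤ p < ∞, and let T and T̂ be bounded linear operators on L^p(X, μ) such that T̂ is a positive majorant of T and ‖T̂‖_{L^p → L^p} < 1. Then I − T and I − T̂ are invertible (with inverses given by convergent Neumann series), and (I − T̂)^{−1} is a positive majorant of (I − T)^{−1}: for every f ∈ L^p, |(I − T)^{−1} f(x)| ≤ (I − T̂)^{−1}(|f|)(x) for almost every x ∈ X. -/

import Mathlib

open MeasureTheory
open scoped ENNReal

noncomputable section

section BanachLattice

variable {E : Type*} [NormedAddCommGroup E] [NormedSpace ℝ E]

/-- Pointwise convergence of the Neumann series of a strict contraction. -/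
lemma hasSum_pow_apply [CompleteSpace E] {T : E →L[ℝ] E} (hT : ‖T‖ < 1) (f : E) :
    HasSum (fun n => (T ^ n) f) ((∑' n, T ^ n) f) :=
  (summable_geometric_of_norm_lt_one hT).hasSum.mapL (ContinuousLinearMap.apply ℝ E f)

variable [Lattice E] {T Tmaj : E →L[ℝ] E}

lemma pow_apply_nonneg (hpos : ∀ g, 0 ≤ g → 0 ≤ Tmaj g) (n : ℕ) {g : E} (hg : 0 ≤ g) :
    0 ≤ (Tmaj ^ n) g := by
  induction n with
  | zero => simpa using hg
  | succ n ih => simpa [pow_succ'] using hpos _ ih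

variable [IsOrderedAddMonoid E]

lemma abs_pow_apply_le (hpos : ∀ g, 0 ≤ g → 0 ≤ Tmaj g) (hmaj : ∀ f, |T f| ≤ Tmaj |f|)
    (n : ℕ) (f : E) : |(T ^ n) f| ≤ (Tmaj ^ n) |f| := by
  induction n with
  | zero => simp
  | succ n ih =>
    simp only [pow_succ', mul_apply_eq_comp]
    refine (hmaj _).trans (sub_nonneg.1 ?_)
    rw [← map_sub]
    exact hpos _ (sub_nonneg.2 ih)

variable [HasSolidNorm E]

lemma opNorm_le_of_abs_apply_le (hmaj : ∀ f, |T f| ≤ Tmaj |f|) : ‖T‖ ≤ ‖Tmaj‖ := by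
  refine T.opNorm_le_bound (norm_nonneg _) fun f => ?_
  calc ‖T f‖ ≤ ‖Tmaj |f|‖ := norm_le_norm_of_abs_le_abs ((hmaj f).trans (le_abs_self _))
    _ ≤ ‖Tmaj‖ * ‖|f|‖ := Tmaj.le_opNorm _
    _ = ‖Tmaj‖ * ‖f‖ := by rw [norm_abs_eq_norm]

lemma tsum_pow_apply_nonneg [CompleteSpace E] (hpos : ∀ g, 0 ≤ g → 0 ≤ Tmaj g)
    (hnorm : ‖Tmaj‖ < 1) {g : E} (hg : 0 ≤ g) : 0 ≤ (∑' n, Tmaj ^ n) g :=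
  (hasSum_pow_apply hnorm g).nonneg fun n => pow_apply_nonneg hpos n hg

lemma abs_tsum_pow_apply_le [CompleteSpace E] (hpos : ∀ g, 0 ≤ g → 0 ≤ Tmaj g)
    (hmaj : ∀ f, |T f| ≤ Tmaj |f|) (hnorm : ‖Tmaj‖ < 1) (f : E) :
    |(∑' n, T ^ n) f| ≤ (∑' n, Tmaj ^ n) |f| := by
  have hT := hasSum_pow_apply ((opNorm_le_of_abs_apply_le hmaj).trans_lt hnorm) f
  have hTmaj := hasSum_pow_apply hnorm |f|
  have h := fun n => abs_pow_apply_le hpos hmaj n f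
  exact abs_le'.2 ⟨hasSum_le (fun n => (abs_le'.1 (h n)).1) hT hTmaj,
    hasSum_le (fun n => (abs_le'.1 (h n)).2) hT.neg hTmaj⟩

end BanachLattice

/-- The lattice inequality `|f| ≤ g` in `Lᵖ` is the pointwise one almost everywhere. -/
lemma Lp_abs_le_iff_ae {X : Type*} [MeasurableSpace X] {μ : Measure X} {p : ℝ≥0∞}
    (f g : Lp ℝ p μ) : |f| ≤ g ↔ ∀ᵐ x ∂μ, |f x| ≤ g x := by
  rw [← Lp.coeFn_le]
  exact Filter.eventually_congr ((Lp.coeFn_abs f).mono fun x hx => by rw [hx])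

lemma Lp_nonneg_iff_ae {X : Type*} [MeasurableSpace X] {μ : Measure X} {p : ℝ≥0∞}
    (g : Lp ℝ p μ) : 0 ≤ g ↔ ∀ᵐ x ∂μ, 0 ≤ g x :=
  (Lp.coeFn_nonneg g).symm

/-- If `Tmaj` is a positive majorant of `T` on `Lᵖ(X, μ)` and `‖Tmaj‖ < 1`, then `I − T` and
`I − Tmaj` are invertible and `(I − Tmaj)⁻¹` is a positive majorant of `(I − T)⁻¹`. -/
theorem neumann_series_positive_majorant
    (X : Type*) [MeasurableSpace X] (μ : Measure X)
    (p : ℝ≥0∞) [Fact (1 ≤ p)] (hp' : p ≠ ⊤)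
    (T Tmaj : Lp ℝ p μ →L[ℝ] Lp ℝ p μ)
    (hpos : ∀ g : Lp ℝ p μ, (∀ᵐ x ∂μ, 0 ≤ g x) → (∀ᵐ x ∂μ, 0 ≤ Tmaj g x))
    (hmaj : ∀ f : Lp ℝ p μ, ∀ᵐ x ∂μ, |(T f) x| ≤ (Tmaj |f|) x)
    (hnorm : ‖Tmaj‖ < 1) :
    ∃ S Smaj : Lp ℝ p μ →L[ℝ] Lp ℝ p μ,
      (1 - T) * S = 1 ∧ S * (1 - T) = 1 ∧
      (1 - Tmaj) * Smaj = 1 ∧ Smaj * (1 - Tmaj) = 1 ∧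
      (∀ g : Lp ℝ p μ, (∀ᵐ x ∂μ, 0 ≤ g x) → (∀ᵐ x ∂μ, 0 ≤ Smaj g x)) ∧
      (∀ f : Lp ℝ p μ, ∀ᵐ x ∂μ, |(S f) x| ≤ (Smaj |f|) x) := by
  simp only [← Lp_nonneg_iff_ae, ← Lp_abs_le_iff_ae] at hpos hmaj ⊢
  have hT : ‖T‖ < 1 := (opNorm_le_of_abs_apply_le hmaj).trans_lt hnorm
  exact ⟨∑' n, T ^ n, ∑' n, Tmaj ^ n, mul_neg_geom_series T hT, geom_series_mul_neg T hT,
    mul_neg_geom_series Tmaj hnorm, geom_series_mul_neg Tmaj hnorm,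
    fun _ hg => tsum_pow_apply_nonneg hpos hnorm hg,
    abs_tsum_pow_apply_le hpos hmaj hnorm⟩

end
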